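/- Pair-propagation through a vertex for R^{(1,2s)}: Let σ ∈ {-s, -s+1, ..., s}. Define h^{in}, h^{out} ∈ ℂ² with arbitrary nonzero h^{out}₁, h^{out}₂, h^{in}₁ and h^{in}₂ = h^{in}₁ h^{out}₂ e^{2λσ}/h^{out}₁, and vectors v^{in}, v^{out} ∈ ℂ^{2s+1} defined recursively by v^{in}₁ arbitrary, v^{in}_{j+1} = (1/b_j(λ)) (v^{in}_j h^{out}₂/h^{out}₁) f^{(j)}(σ;u)/f^{(j-1)}(σ;u), and v^{out}_j = a₁(u) (h^{in}₁ v^{in}_j/h^{out}₁) f^{(j-1)}(σ;u−λ)/f^{(j-1)}(σ;u). Then for all 1 ≤ j ≤ 2s+1: a_j(u) v^{in}_j h^{in}₁ + b_{j-1}(λ) v^{in}_{j-1} h^{in}₂ = v^{out}_j h^{out}₁ and a_{2s+2-j}(u) v^{in}_j h^{in}₂ + b_j(λ) v^{in}_{j+1} h^{in}₁ = v^{out}_j h^{out}₂ (with the conventions b₀ = b_{2s+1} = 0). -/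

import Mathlib

open Finset Complex

/-- q-integer `[n] = sinh(nλ)/sinh(λ)` with `q = e^λ`. -/
noncomputable def sqint (lam : ℂ) (n : ℕ) : ℂ := Complex.sinh (n * lam) / Complex.sinh lam

/-- q-factorial. -/
noncomputable def sqfact (lam : ℂ) : ℕ → ℂ
  | 0 => 1
  | n + 1 => sqint lam (n + 1) * sqfact lam n

/-- q-binomial coefficient `[m choose n]`, zero when `n > m`. -/
noncomputable def sqbinom (lam : ℂ) (m n : ℕ) : ℂ :=
  if n ≤ m then sqfact lam m / (sqfact lam (m - n) * sqfact lam n) else 0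

/-- The function
`f^{(p)}(σ;u) = ∑_{k=0}^{p} (-e^{2λσ})^k [p choose k]_q
  ∏_{j=1}^{k} sinh(u+(j-1)λ) ∏_{j=k+1}^{p} sinh(u+(2s+j-p)λ)`,
where `s2 = 2s`. -/
noncomputable def ff (s2 : ℕ) (lam σ u : ℂ) (p : ℕ) : ℂ :=
  ∑ k ∈ range (p + 1),
    (-Complex.exp (2 * lam * σ)) ^ k * sqbinom lam p k
      * (∏ j ∈ range k, Complex.sinh (u + (j : ℂ) * lam))
      * (∏ j ∈ Finset.Ico k p, Complex.sinh (u + ((s2 : ℂ) + (j : ℂ) + 1 - (p : ℂ)) * lam))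

/-- `b_j(λ) = √(sinh(jλ) sinh((2s+1−j)λ))` (principal square root), `s2 = 2s`.
Note `b_0 = b_{2s+1} = 0`. -/
noncomputable def bCoef (s2 : ℕ) (lam : ℂ) (j : ℕ) : ℂ :=
  (Complex.sinh ((j : ℂ) * lam) * Complex.sinh (((s2 : ℂ) + 1 - (j : ℂ)) * lam)) ^ ((1 : ℂ) / 2)

/-! ### Auxiliary material -/

/-- Rising product. -/
noncomputable def auxA (lam u : ℂ) (k : ℕ) : ℂ :=
  ∏ j ∈ range k, Complex.sinh (u + (j : ℂ) * lam)

/-- Falling product. -/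
noncomputable def auxB (s2 : ℕ) (lam u : ℂ) (n : ℕ) : ℂ :=
  ∏ j ∈ range n, Complex.sinh (u + ((s2 : ℂ) - (j : ℂ)) * lam)

lemma sinh_three (X Y Z : ℂ) :
    Complex.sinh (X + Y) * Complex.sinh (Z + X)
      = Complex.sinh Y * Complex.sinh Z + Complex.sinh X * Complex.sinh (Z + X + Y) := by
  simp only [Complex.sinh_add, Complex.cosh_add]
  linear_combination (Complex.sinh Y * Complex.sinh Z) * Complex.cosh_sq X

lemma auxA_shift (lam u : ℂ) (k : ℕ) :
    auxA lam (u - lam) (k + 1) = Complex.sinh (u - lam) * auxA lam u k := by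
  unfold auxA
  rw [prod_range_succ', mul_comm]
  congr 1
  · congr 1; push_cast; ring
  · refine prod_congr rfl fun j _ => ?_
    congr 1; push_cast; ring

lemma auxA_succ (lam u : ℂ) (k : ℕ) :
    auxA lam u (k + 1) = auxA lam u k * Complex.sinh (u + k * lam) := by
  unfold auxA
  rw [prod_range_succ]

lemma auxB_succ (s2 : ℕ) (lam u : ℂ) (n : ℕ) :
    auxB s2 lam u (n + 1) = auxB s2 lam u n * Complex.sinh (u + ((s2 : ℂ) - n) * lam) := by
  unfold auxB
  rw [prod_range_succ]

lemma auxB_shift (s2 : ℕ) (lam u : ℂ) (n : ℕ) :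
    Complex.sinh (u + s2 * lam) * auxB s2 lam (u - lam) n = auxB s2 lam u (n + 1) := by
  unfold auxB
  rw [prod_range_succ', mul_comm]
  congr 1
  · refine prod_congr rfl fun j _ => ?_
    congr 1; push_cast; ring
  · congr 1; push_cast; ring

lemma ff_eq (s2 : ℕ) (lam σ u : ℂ) (p : ℕ) :
    ff s2 lam σ u p = ∑ k ∈ range (p + 1),
      (-Complex.exp (2 * lam * σ)) ^ k * sqbinom lam p k * auxA lam u k
        * auxB s2 lam u (p - k) := by
  unfold ff auxA auxB
  refine sum_congr rfl fun k hk => ?_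
  have hk' : k ≤ p := by simpa [Nat.lt_succ_iff] using hk
  congr 1
  rw [prod_Ico_eq_prod_range, ← prod_range_reflect]
  refine prod_congr rfl fun j hj => ?_
  have hj' : j < p - k := by simpa using hj
  congr 1
  have : ((k + (p - k - 1 - j) : ℕ) : ℂ) = (p : ℂ) - 1 - j := by
    have h : k + (p - k - 1 - j) + 1 + j = p := by omega
    have h2 : ((k + (p - k - 1 - j) + 1 + j : ℕ) : ℂ) = p := by rw [h]
    rw [Nat.cast_add, Nat.cast_add _ 1] at h2
    rw [← h2]; push_cast; ring
  rw [this]; ring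

lemma sqbinom_of_lt (lam : ℂ) {p k : ℕ} (h : p < k) : sqbinom lam p k = 0 := by
  simp [sqbinom, Nat.not_le.mpr h]

section qb
variable {s2 : ℕ} {lam : ℂ} (hlam : Complex.sinh lam ≠ 0)
  (hS : ∀ j : ℕ, 1 ≤ j → j ≤ s2 → Complex.sinh ((j : ℂ) * lam) ≠ 0)

lemma sqfact_ne (hlam : Complex.sinh lam ≠ 0)
    (hS : ∀ j : ℕ, 1 ≤ j → j ≤ s2 → Complex.sinh ((j : ℂ) * lam) ≠ 0)
    (p : ℕ) (hp : p ≤ s2) : sqfact lam p ≠ 0 := by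
  induction p with
  | zero => simp [sqfact]
  | succ n ih =>
    rw [sqfact]
    exact mul_ne_zero (div_ne_zero (hS _ (by omega) hp) hlam) (ih (by omega))

lemma sqbinom_zero (hlam : Complex.sinh lam ≠ 0)
    (hS : ∀ j : ℕ, 1 ≤ j → j ≤ s2 → Complex.sinh ((j : ℂ) * lam) ≠ 0)
    (p : ℕ) (hp : p ≤ s2) : sqbinom lam p 0 = 1 := by
  have := sqfact_ne hlam hS p hp
  simp [sqbinom, sqfact, this]

lemma sqfact_succ (hlam : Complex.sinh lam ≠ 0) (n : ℕ) :
    Complex.sinh lam * sqfact lam (n + 1) = Complex.sinh (((n : ℂ) + 1) * lam) * sqfact lam n := by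
  rw [sqfact, sqint]
  push_cast
  field_simp

/-- `S(k+1) c(p,k+1) = S(p-k) c(p,k)`. -/
lemma sqbinom_step (hlam : Complex.sinh lam ≠ 0)
    (hS : ∀ j : ℕ, 1 ≤ j → j ≤ s2 → Complex.sinh ((j : ℂ) * lam) ≠ 0)
    (p : ℕ) (hp : p ≤ s2) (k : ℕ) (hk : k ≤ p) :
    Complex.sinh (((k : ℂ) + 1) * lam) * sqbinom lam p (k + 1)
      = Complex.sinh (((p : ℂ) - k) * lam) * sqbinom lam p k := by
  rcases hk.eq_or_lt with rfl | hk
  · rw [sqbinom_of_lt lam (Nat.lt_succ_self k)]; simp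
  obtain ⟨d, rfl⟩ := Nat.exists_eq_add_of_lt hk
  have e1 : k + d + 1 - (k + 1) = d := by omega
  have e2 : k + d + 1 - k = d + 1 := by omega
  have h1 := sqfact_ne hlam hS d (by omega)
  have h2 := sqfact_ne hlam hS (d + 1) (by omega)
  have h3 := sqfact_ne hlam hS k (by omega)
  have h4 := sqfact_ne hlam hS (k + 1) (by omega)
  have r1 := sqfact_succ hlam d
  have r2 := sqfact_succ hlam k
  have e3 : (((k + d + 1 : ℕ) : ℂ) - k) * lam = ((d : ℂ) + 1) * lam := by push_cast; ring
  rw [sqbinom, sqbinom, if_pos (by omega), if_pos (by omega), e1, e2, e3]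
  generalize Complex.sinh (((k : ℂ) + 1) * lam) = Sk at *
  generalize Complex.sinh (((d : ℂ) + 1) * lam) = Sd at *
  field_simp
  apply mul_left_cancel₀ hlam
  linear_combination sqfact lam (k + d + 1) * (Sk * sqfact lam k * r1 - Sd * sqfact lam d * r2)

/-- `S(p+1) c(p,k) = S(k+1) c(p+1,k+1)`. -/
lemma sqbinom_diag (hlam : Complex.sinh lam ≠ 0)
    (hS : ∀ j : ℕ, 1 ≤ j → j ≤ s2 → Complex.sinh ((j : ℂ) * lam) ≠ 0)
    (p : ℕ) (hp : p + 1 ≤ s2) (k : ℕ) (hk : k ≤ p) :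
    Complex.sinh (((p : ℂ) + 1) * lam) * sqbinom lam p k
      = Complex.sinh (((k : ℂ) + 1) * lam) * sqbinom lam (p + 1) (k + 1) := by
  have e1 : p + 1 - (k + 1) = p - k := by omega
  have h1 := sqfact_ne hlam hS (p - k) (by omega)
  have h3 := sqfact_ne hlam hS k (by omega)
  have h4 := sqfact_ne hlam hS (k + 1) (by omega)
  have r1 := sqfact_succ hlam p
  have r2 := sqfact_succ hlam k
  rw [sqbinom, sqbinom, if_pos (by omega), if_pos (by omega), e1]
  generalize Complex.sinh (((k : ℂ) + 1) * lam) = Sk at *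
  generalize Complex.sinh (((p : ℂ) + 1) * lam) = Sp at *
  field_simp
  apply mul_left_cancel₀ hlam
  linear_combination (Sp * sqfact lam p) * r2 - (Sk * sqfact lam k) * r1

/-- `S(p+1) c(p,k+1) = S(p-k) c(p+1,k+1)`. -/
lemma sqbinom_up (hlam : Complex.sinh lam ≠ 0)
    (hS : ∀ j : ℕ, 1 ≤ j → j ≤ s2 → Complex.sinh ((j : ℂ) * lam) ≠ 0)
    (p : ℕ) (hp : p + 1 ≤ s2) (k : ℕ) (hk : k ≤ p) :
    Complex.sinh (((p : ℂ) + 1) * lam) * sqbinom lam p (k + 1)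
      = Complex.sinh (((p : ℂ) - k) * lam) * sqbinom lam (p + 1) (k + 1) := by
  have h1 := sqbinom_diag hlam hS p hp k hk
  have h2 := sqbinom_step hlam hS p (by omega) k hk
  have h3 : Complex.sinh (((k : ℂ) + 1) * lam) ≠ 0 := by
    have := hS (k + 1) (by omega) (by omega)
    push_cast at this; exact this
  apply mul_left_cancel₀ h3
  linear_combination Complex.sinh (((p : ℂ) + 1) * lam) * h2
    + Complex.sinh (((p : ℂ) - k) * lam) * h1

/-- Pascal rule. -/
lemma sqbinom_pascal (hlam : Complex.sinh lam ≠ 0)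
    (hS : ∀ j : ℕ, 1 ≤ j → j ≤ s2 → Complex.sinh ((j : ℂ) * lam) ≠ 0)
    (p : ℕ) (hp : p + 1 ≤ s2) (k : ℕ) (hk : k ≤ p) :
    sqbinom lam (p + 1) (k + 1)
      = Complex.exp (((k : ℂ) + 1) * lam) * sqbinom lam p (k + 1)
        + Complex.exp (-(((p : ℂ) - k) * lam)) * sqbinom lam p k := by
  have h1 := sqbinom_diag hlam hS p hp k hk
  have h2 := sqbinom_up hlam hS p hp k hk
  have h3 : Complex.sinh (((p : ℂ) + 1) * lam) ≠ 0 := by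
    have := hS (p + 1) (by omega) (by omega)
    push_cast at this; exact this
  have key : Complex.sinh (((p : ℂ) + 1) * lam)
      = Complex.exp (((k : ℂ) + 1) * lam) * Complex.sinh (((p : ℂ) - k) * lam)
        + Complex.exp (-(((p : ℂ) - k) * lam)) * Complex.sinh (((k : ℂ) + 1) * lam) := by
    have e : ((p : ℂ) + 1) * lam = ((k : ℂ) + 1) * lam + ((p : ℂ) - k) * lam := by ring
    rw [e, Complex.sinh_add, ← Complex.cosh_add_sinh (((k : ℂ) + 1) * lam),
      ← Complex.cosh_sub_sinh (((p : ℂ) - k) * lam)]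
    ring
  apply mul_left_cancel₀ h3
  linear_combination sqbinom lam (p + 1) (k + 1) * key
    - Complex.exp (((k : ℂ) + 1) * lam) * h2
    - Complex.exp (-(((p : ℂ) - k) * lam)) * h1

lemma sum_succ_of_last (g : ℕ → ℂ) (p : ℕ) (h : g (p + 1) = 0) :
    ∑ k ∈ range (p + 1), g k = ∑ k ∈ range (p + 1), g (k + 1) + g 0 := by
  rw [← sum_range_succ' g (p + 1), sum_range_succ g (p + 1), h, add_zero]

/-- The generating polynomial of the q-binomials. -/
noncomputable def auxQ (lam : ℂ) (p : ℕ) (y : ℂ) : ℂ :=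
  ∑ k ∈ range (p + 1), (-y) ^ k * sqbinom lam p k

/-- Common algebra behind the q-binomial theorem. -/
lemma pascal_sum (hlam : Complex.sinh lam ≠ 0)
    (hS : ∀ j : ℕ, 1 ≤ j → j ≤ s2 → Complex.sinh ((j : ℂ) * lam) ≠ 0)
    (p : ℕ) (hp : p ≤ s2) (y : ℂ) :
    1 + ∑ k ∈ range (p + 1), (-y) ^ (k + 1) *
      (Complex.exp (((k : ℂ) + 1) * lam) * sqbinom lam p (k + 1)
        + Complex.exp (-(((p : ℂ) - k) * lam)) * sqbinom lam p k)
      = (1 - y * Complex.exp (-(p * lam))) * auxQ lam p (y * Complex.exp lam) := by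
  rw [sub_mul, one_mul]
  have hpow : ∀ k : ℕ, (-(y * Complex.exp lam)) ^ k = (-y) ^ k * Complex.exp (k * lam) := by
    intro k
    rw [← neg_mul, mul_pow, ← Complex.exp_nat_mul]
  have h1 : auxQ lam p (y * Complex.exp lam) = ∑ k ∈ range (p + 1), (-y) ^ (k + 1) *
      (Complex.exp (((k : ℂ) + 1) * lam) * sqbinom lam p (k + 1)) + 1 := by
    unfold auxQ
    rw [sum_succ_of_last _ _ (by rw [sqbinom_of_lt lam (Nat.lt_succ_self p), mul_zero])]
    congr 1
    · refine sum_congr rfl fun k _ => ?_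
      rw [hpow]; push_cast; ring
    · rw [sqbinom_zero hlam hS p hp]; simp
  have h2 : y * Complex.exp (-(p * lam)) * auxQ lam p (y * Complex.exp lam)
      = -∑ k ∈ range (p + 1), (-y) ^ (k + 1) *
      (Complex.exp (-(((p : ℂ) - k) * lam)) * sqbinom lam p k) := by
    unfold auxQ
    rw [mul_sum, ← sum_neg_distrib]
    refine sum_congr rfl fun k _ => ?_
    rw [hpow, show -(((p : ℂ) - k) * lam) = -(p * lam) + k * lam by ring, Complex.exp_add]
    ring
  rw [h2, h1]
  simp only [mul_add, sum_add_distrib]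
  ring

lemma auxQ_succ (hlam : Complex.sinh lam ≠ 0)
    (hS : ∀ j : ℕ, 1 ≤ j → j ≤ s2 → Complex.sinh ((j : ℂ) * lam) ≠ 0)
    (p : ℕ) (hp : p + 1 ≤ s2) (y : ℂ) :
    auxQ lam (p + 1) y
      = (1 - y * Complex.exp (-(p * lam))) * auxQ lam p (y * Complex.exp lam) := by
  rw [← pascal_sum hlam hS p (by omega)]
  unfold auxQ
  rw [sum_range_succ', sqbinom_zero hlam hS (p + 1) hp, add_comm]
  congr 1
  · simp
  · refine sum_congr rfl fun k hk => ?_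
    rw [sqbinom_pascal hlam hS p hp k (by simpa [Nat.lt_succ_iff] using hk)]

lemma auxQ_root (hlam : Complex.sinh lam ≠ 0)
    (hS : ∀ j : ℕ, 1 ≤ j → j ≤ s2 → Complex.sinh ((j : ℂ) * lam) ≠ 0)
    (p : ℕ) (hp : p ≤ s2) (m : ℕ) (hm : m < p) :
    auxQ lam p (Complex.exp ((2 * m - p + 1) * lam)) = 0 := by
  induction p with
  | zero => omega
  | succ p ih =>
    rw [auxQ_succ hlam hS p hp, ← Complex.exp_add, ← Complex.exp_add]
    rcases (Nat.lt_succ_iff.mp hm).eq_or_lt with rfl | h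
    · have : (2 * (m : ℂ) - ((m + 1 : ℕ) : ℂ) + 1) * lam + -(m * lam) = 0 := by
        push_cast; ring
      rw [this]; simp
    · have := ih (by omega) h
      rw [← mul_zero (1 - Complex.exp ((2 * (m : ℂ) - ((p + 1 : ℕ) : ℂ) + 1) * lam + -(p * lam))),
        ← this]
      congr 3
      push_cast; ring

lemma ff_shift (hlam : Complex.sinh lam ≠ 0)
    (hS : ∀ j : ℕ, 1 ≤ j → j ≤ s2 → Complex.sinh ((j : ℂ) * lam) ≠ 0)
    (σ u : ℂ) (p : ℕ) (hp : p ≤ s2) :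
    Complex.sinh (u + s2 * lam) * ff s2 lam σ (u - lam) p
      = ∑ k ∈ range (p + 1), (-Complex.exp (2 * lam * σ)) ^ (k + 1) * sqbinom lam p (k + 1)
          * (Complex.sinh (u - lam) * auxA lam u k) * auxB s2 lam u (p - k)
        + auxB s2 lam u (p + 1) := by
  rw [ff_eq, sum_succ_of_last _ _ (by rw [sqbinom_of_lt lam (Nat.lt_succ_self p)]; ring),
    mul_add, mul_sum]
  congr 1
  · refine sum_congr rfl fun k hk => ?_
    have hk' : k ≤ p := by simpa [Nat.lt_succ_iff] using hk
    rcases hk'.eq_or_lt with rfl | hk'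
    · rw [sqbinom_of_lt lam (Nat.lt_succ_self k)]; ring
    · rw [auxA_shift, show p - k = (p - (k + 1)) + 1 by omega, ← auxB_shift]
      ring
  · rw [sqbinom_zero hlam hS p hp, ← auxB_shift]
    simp [auxA]

lemma ff_succ_eq (hlam : Complex.sinh lam ≠ 0)
    (hS : ∀ j : ℕ, 1 ≤ j → j ≤ s2 → Complex.sinh ((j : ℂ) * lam) ≠ 0)
    (σ u : ℂ) (p : ℕ) (hp : p + 1 ≤ s2) :
    ff s2 lam σ u (p + 1)
      = ∑ k ∈ range (p + 1), (-Complex.exp (2 * lam * σ)) ^ (k + 1) * sqbinom lam (p + 1) (k + 1)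
          * (auxA lam u k * Complex.sinh (u + k * lam)) * auxB s2 lam u (p - k)
        + auxB s2 lam u (p + 1) := by
  rw [ff_eq, sum_range_succ']
  congr 1
  · refine sum_congr rfl fun k hk => ?_
    rw [auxA_succ, show p + 1 - (k + 1) = p - k by omega]
  · rw [sqbinom_zero hlam hS _ hp]
    simp [auxA]

lemma x_ff (σ u w : ℂ) (p : ℕ) :
    Complex.exp (2 * lam * σ) * w * ff s2 lam σ u p
      = -∑ k ∈ range (p + 1), (-Complex.exp (2 * lam * σ)) ^ (k + 1) * sqbinom lam p k
          * (auxA lam u k * w) * auxB s2 lam u (p - k) := by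
  rw [ff_eq, mul_sum, ← sum_neg_distrib]
  refine sum_congr rfl fun k _ => ?_
  ring

/-- Second equation for `p < 2s`. -/
lemma ff_recA (hlam : Complex.sinh lam ≠ 0)
    (hS : ∀ j : ℕ, 1 ≤ j → j ≤ s2 → Complex.sinh ((j : ℂ) * lam) ≠ 0)
    (σ u : ℂ) (p : ℕ) (hp : p + 1 ≤ s2) :
    ff s2 lam σ u (p + 1) + Complex.exp (2 * lam * σ) * Complex.sinh (u + p * lam) * ff s2 lam σ u p
      = Complex.sinh (u + s2 * lam) * ff s2 lam σ (u - lam) p := by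
  rw [ff_shift hlam hS σ u p (by omega), ff_succ_eq hlam hS σ u p hp, x_ff, add_right_comm,
    ← sub_eq_add_neg, ← sum_sub_distrib]
  congr 1
  refine sum_congr rfl fun k hk => ?_
  have hk' : k ≤ p := by simpa [Nat.lt_succ_iff] using hk
  have h1 := sqbinom_diag hlam hS p hp k hk'
  have h2 := sqbinom_up hlam hS p hp k hk'
  have h3 : Complex.sinh (((p : ℂ) + 1) * lam) ≠ 0 := by
    have := hS (p + 1) (by omega) (by omega)
    push_cast at this; exact this
  have key := sinh_three (((k : ℂ) + 1) * lam) (((p : ℂ) - k) * lam) (u - lam)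
  rw [show ((k : ℂ) + 1) * lam + ((p : ℂ) - k) * lam = ((p : ℂ) + 1) * lam by ring,
    show u - lam + ((k : ℂ) + 1) * lam + ((p : ℂ) - k) * lam = u + p * lam by ring,
    show u - lam + ((k : ℂ) + 1) * lam = u + k * lam by ring] at key
  have core : sqbinom lam (p + 1) (k + 1) * Complex.sinh (u + k * lam)
      - sqbinom lam p k * Complex.sinh (u + p * lam)
      = sqbinom lam p (k + 1) * Complex.sinh (u - lam) := by
    apply mul_left_cancel₀ h3
    linear_combination sqbinom lam (p + 1) (k + 1) * key - Complex.sinh (u + p * lam) * h1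
      - Complex.sinh (u - lam) * h2
  linear_combination ((-Complex.exp (2 * lam * σ)) ^ (k + 1) * auxA lam u k
    * auxB s2 lam u (p - k)) * core

/-- First equation. -/
lemma ff_recB (hlam : Complex.sinh lam ≠ 0)
    (hS : ∀ j : ℕ, 1 ≤ j → j ≤ s2 → Complex.sinh ((j : ℂ) * lam) ≠ 0)
    (σ u : ℂ) (p : ℕ) (hp : p + 1 ≤ s2) :
    Complex.sinh (u + ((s2 : ℂ) - (p + 1)) * lam) * ff s2 lam σ u (p + 1)
      + Complex.exp (2 * lam * σ) *
        (Complex.sinh (((p : ℂ) + 1) * lam) * Complex.sinh (((s2 : ℂ) - p) * lam))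
        * ff s2 lam σ u p
      = Complex.sinh (u + s2 * lam) * ff s2 lam σ (u - lam) (p + 1) := by
  have hs := ff_shift hlam hS σ u (p + 1) hp
  rw [sum_range_succ, sqbinom_of_lt lam (Nat.lt_succ_self (p + 1)),
    auxB_succ s2 lam u (p + 1)] at hs
  rw [hs, ff_succ_eq hlam hS σ u p hp, x_ff, mul_add, mul_sum, add_right_comm, ← sub_eq_add_neg, ← sum_sub_distrib]
  simp only [mul_zero, zero_mul, add_zero]
  congr 1
  · refine sum_congr rfl fun k hk => ?_
    have hk' : k ≤ p := by simpa [Nat.lt_succ_iff] using hk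
    have h1 := sqbinom_diag hlam hS p hp k hk'
    have key := sinh_three (u - lam) (((s2 : ℂ) - p) * lam) (((k : ℂ) + 1) * lam)
    rw [show u - lam + ((s2 : ℂ) - p) * lam = u + ((s2 : ℂ) - (p + 1)) * lam by ring,
      show ((k : ℂ) + 1) * lam + (u - lam) + ((s2 : ℂ) - p) * lam
        = u + ((s2 : ℂ) - (p - k)) * lam by ring,
      show ((k : ℂ) + 1) * lam + (u - lam) = u + k * lam by ring] at key
    rw [show p + 1 - k = p - k + 1 by omega, auxB_succ, Nat.cast_sub hk']
    linear_combination ((-Complex.exp (2 * lam * σ)) ^ (k + 1) * auxA lam u k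
      * auxB s2 lam u (p - k)) * (sqbinom lam (p + 1) (k + 1) * key
        - Complex.sinh (((s2 : ℂ) - p) * lam) * h1)
  · push_cast; ring

lemma auxAB (u : ℂ) (k : ℕ) (hk : k ≤ s2) :
    auxA lam u k * Complex.sinh (u + k * lam) * auxB s2 lam u (s2 - k)
      = auxB s2 lam u (s2 + 1) := by
  induction k with
  | zero =>
    rw [auxB_succ]; simp [auxA]; ring
  | succ k ih =>
    rw [← ih (by omega), auxA_succ, show s2 - k = s2 - (k + 1) + 1 by omega, auxB_succ,
      Nat.cast_sub hk]
    push_cast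
    rw [show (s2 : ℂ) - (s2 - (k + 1)) = k + 1 by ring]
    ring

/-- Second equation for `p = 2s`. -/
lemma ff_last (hlam : Complex.sinh lam ≠ 0)
    (hS : ∀ j : ℕ, 1 ≤ j → j ≤ s2 → Complex.sinh ((j : ℂ) * lam) ≠ 0)
    (σ u : ℂ) (m : ℕ) (hm : m ≤ s2) (hσ : σ = -(s2 : ℂ) / 2 + (m : ℂ)) :
    Complex.exp (2 * lam * σ) * Complex.sinh (u + s2 * lam) * ff s2 lam σ u s2
      = Complex.sinh (u + s2 * lam) * ff s2 lam σ (u - lam) s2 := by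
  have hx : Complex.exp (2 * lam * σ) = Complex.exp ((2 * m - s2) * lam) := by
    rw [hσ]; congr 1; ring
  have hz : (1 - Complex.exp (2 * lam * σ) * Complex.exp (-(s2 * lam)))
      * auxQ lam s2 (Complex.exp (2 * lam * σ) * Complex.exp lam) = 0 := by
    rw [hx, ← Complex.exp_add, ← Complex.exp_add]
    rcases hm.eq_or_lt with rfl | h
    · rw [show (2 * (m : ℂ) - m) * lam + -(m * lam) = 0 by ring]; simp
    · rw [show (2 * (m : ℂ) - s2) * lam + lam = (2 * m - s2 + 1) * lam by ring,
        auxQ_root hlam hS s2 le_rfl m h, mul_zero]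
  rw [← pascal_sum hlam hS s2 le_rfl] at hz
  symm
  rw [← sub_eq_zero, ff_shift hlam hS σ u s2 le_rfl, x_ff, sub_neg_eq_add, add_right_comm,
    ← sum_add_distrib, ← mul_zero (auxB s2 lam u (s2 + 1)), ← hz, mul_add, mul_one, add_comm,
    mul_sum]
  congr 1
  refine sum_congr rfl fun k hk => ?_
  have hk' : k ≤ s2 := by simpa [Nat.lt_succ_iff] using hk
  have h2 := sqbinom_step hlam hS s2 le_rfl k hk'
  rw [← auxAB u k hk']
  have k1 : Complex.sinh (u - lam)
      = Complex.exp (((k : ℂ) + 1) * lam) * Complex.sinh (u + k * lam)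
        - Complex.exp (u + k * lam) * Complex.sinh (((k : ℂ) + 1) * lam) := by
    rw [show u - lam = (u + k * lam) - ((k : ℂ) + 1) * lam by ring, Complex.sinh_sub,
      ← Complex.cosh_add_sinh, ← Complex.cosh_add_sinh]
    ring
  have k2 : Complex.sinh (u + s2 * lam)
      = Complex.exp (-(((s2 : ℂ) - k) * lam)) * Complex.sinh (u + k * lam)
        + Complex.exp (u + k * lam) * Complex.sinh (((s2 : ℂ) - k) * lam) := by
    rw [show u + s2 * lam = (u + k * lam) + ((s2 : ℂ) - k) * lam by ring, Complex.sinh_add,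
      ← Complex.cosh_sub_sinh, ← Complex.cosh_add_sinh]
    ring
  rw [k1, k2]
  linear_combination (-(-Complex.exp (2 * lam * σ)) ^ (k + 1) * auxA lam u k
      * auxB s2 lam u (s2 - k)) * Complex.exp (u + k * lam) * h2

end qb

lemma bCoef_sq (s2 : ℕ) (lam : ℂ) (j : ℕ) :
    bCoef s2 lam j * bCoef s2 lam j
      = Complex.sinh ((j : ℂ) * lam) * Complex.sinh (((s2 : ℂ) + 1 - (j : ℂ)) * lam) := by
  unfold bCoef
  rw [← sq, one_div]
  exact_mod_cast Complex.cpow_nat_inv_pow _ (n := 2) (by norm_num)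

/-- Pair-propagation through a vertex for `R^{(1,2s)}` (Proposition 3):
with `σ ∈ {-s, …, s}`, `h^{in}₂ = h^{in}₁ h^{out}₂ e^{2λσ}/h^{out}₁`, and
`v^{in}, v^{out}` defined by the recursions (eqs. (4.19)–(4.21)), the pair-propagation
equations `a_j(u) v^{in}_j h^{in}₁ + b_{j-1} v^{in}_{j-1} h^{in}₂ = v^{out}_j h^{out}₁`
and `a_{2s+2-j}(u) v^{in}_j h^{in}₂ + b_j v^{in}_{j+1} h^{in}₁ = v^{out}_j h^{out}₂`
hold for `1 ≤ j ≤ 2s+1`. -/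
theorem pair_propagation (s2 : ℕ) (hs2 : 1 ≤ s2) (lam u : ℂ)
    (hlam : Complex.sinh lam ≠ 0)
    (m : ℕ) (hm : m ≤ s2) (σ : ℂ) (hσ : σ = -(s2 : ℂ) / 2 + (m : ℂ))
    (hb : ∀ j, 1 ≤ j → j ≤ s2 → bCoef s2 lam j ≠ 0)
    (hfne : ∀ j, j ≤ s2 → ff s2 lam σ u j ≠ 0)
    (h1out h2out h1in h2in : ℂ)
    (hh1out : h1out ≠ 0) (hh2out : h2out ≠ 0) (hh1in : h1in ≠ 0)
    (hh2in : h2in = h1in * h2out * Complex.exp (2 * lam * σ) / h1out)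
    (vin vout : ℕ → ℂ)
    (hvin : ∀ j, 1 ≤ j → j ≤ s2 →
      vin (j + 1) = (1 / bCoef s2 lam j) * (vin j * h2out / h1out)
        * (ff s2 lam σ u j / ff s2 lam σ u (j - 1)))
    (hvout : ∀ j, 1 ≤ j → j ≤ s2 + 1 →
      vout j = Complex.sinh (u + (s2 : ℂ) * lam) * (h1in * vin j / h1out)
        * (ff s2 lam σ (u - lam) (j - 1) / ff s2 lam σ u (j - 1))) :
    ∀ j, 1 ≤ j → j ≤ s2 + 1 →
      (Complex.sinh (u + ((s2 : ℂ) + 1 - (j : ℂ)) * lam) * vin j * h1in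
          + bCoef s2 lam (j - 1) * vin (j - 1) * h2in = vout j * h1out)
      ∧ (Complex.sinh (u + ((j : ℂ) - 1) * lam) * vin j * h2in
          + bCoef s2 lam j * vin (j + 1) * h1in = vout j * h2out) := by
  have hS : ∀ j : ℕ, 1 ≤ j → j ≤ s2 → Complex.sinh ((j : ℂ) * lam) ≠ 0 := by
    intro j h1 h2 h0
    have h := bCoef_sq s2 lam j
    rw [h0, zero_mul] at h
    exact hb j h1 h2 (mul_self_eq_zero.mp h)
  intro j hj1 hj2
  obtain ⟨p, rfl⟩ : ∃ p, j = p + 1 := ⟨j - 1, by omega⟩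
  have hF := hfne p (by omega)
  have hvo := hvout (p + 1) hj1 hj2
  simp only [Nat.add_sub_cancel] at hvo ⊢
  rw [hvo, hh2in]
  constructor
  · rcases p with _ | p
    · have h0 : bCoef s2 lam 0 = 0 := by simp [bCoef]
      have f0 : ∀ w, ff s2 lam σ w 0 = 1 := by intro w; simp [ff, sqbinom, sqfact]
      rw [h0, f0, f0]
      rw [show u + ((s2 : ℂ) + 1 - ((0 + 1 : ℕ) : ℂ)) * lam = u + s2 * lam by push_cast; ring]
      field_simp
      ring
    · have hB := ff_recB hlam hS σ u p (by omega)
      have hv := hvin (p + 1) (by omega) (by omega)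
      have hbp := hb (p + 1) (by omega) (by omega)
      have hsq := bCoef_sq s2 lam (p + 1)
      have hF0 := hfne p (by omega)
      simp only [Nat.add_sub_cancel] at hv
      push_cast at hsq ⊢
      rw [show ((s2 : ℂ) + 1 - (p + 1)) = s2 - p by ring] at hsq
      rw [← hsq] at hB
      rw [show (s2 : ℂ) + 1 - (p + 1 + 1) = s2 - (p + 1) by ring]
      have hv' : vin (p + 1) * h2out * ff s2 lam σ u (p + 1)
          = vin (p + 1 + 1) * bCoef s2 lam (p + 1) * h1out * ff s2 lam σ u p := by
        rw [hv]; field_simp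
      generalize Complex.exp (2 * lam * σ) = E at *
      generalize Complex.sinh (u + (s2 : ℂ) * lam) = W2 at *
      generalize Complex.sinh (u + ((s2 : ℂ) - (p + 1)) * lam) = W1 at *
      field_simp
      linear_combination h1out * vin (p + 1 + 1) * hB + bCoef s2 lam (p + 1) * E * hv'
  · push_cast
    rw [show u + ((p : ℂ) + 1 - 1) * lam = u + p * lam by ring]
    rcases (Nat.lt_succ_iff.mp hj2).eq_or_lt with rfl | hp
    · have h0 : bCoef p lam (p + 1) = 0 := by simp [bCoef]
      have hL := ff_last hlam hS σ u m hm hσ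
      rw [h0]
      generalize Complex.exp (2 * lam * σ) = E at *
      generalize Complex.sinh (u + (p : ℂ) * lam) = W2 at *
      field_simp
      linear_combination vin (p + 1) * h2out * hL
    · have hA := ff_recA hlam hS σ u p hp
      have hv := hvin (p + 1) (by omega) (by omega)
      have hbp := hb (p + 1) (by omega) (by omega)
      simp only [Nat.add_sub_cancel] at hv
      rw [hv]
      generalize Complex.exp (2 * lam * σ) = E at *
      generalize Complex.sinh (u + (s2 : ℂ) * lam) = W2 at *
      generalize Complex.sinh (u + (p : ℂ) * lam) = W1 at *
      field_simp
      linear_combination vin (p + 1) * hA
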